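/- Let μ be a finite positive measure on ℝ² supported on the circle C_r of radius r (arc-length measure). Then (Q(-k²)𝟙, 𝟙)_{L²(μ)} := (1/(2π))∬ K₀(k|x-y|) dμ(x)dμ(y) = 2π r² I₀(kr) K₀(kr) for all k > 0. -/

import Mathlib

open MeasureTheory

/-- The modified Bessel function of the first kind of order zero, via
`I₀(x) = (1/π) ∫₀^π exp (x cos θ) dθ`. -/
noncomputable def besselI0 (x : ℝ) : ℝ :=
  (1 / Real.pi) * ∫ θ in (0 : ℝ)..Real.pi, Real.exp (x * Real.cos θ)

/-- The Macdonald function of order zero, via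
`K₀(x) = ∫₀^∞ exp(-x cosh t) dt`. -/
noncomputable def besselK0 (x : ℝ) : ℝ :=
  ∫ t in Set.Ioi (0 : ℝ), Real.exp (-x * Real.cosh t)

/-- Arc-length measure on the circle of radius `r` centered at the origin in `ℝ²`:
the pushforward of `r` times Lebesgue measure on `[0, 2π)` under the standard
parameterization. -/
noncomputable def circleMeasure (r : ℝ) : Measure (EuclideanSpace ℝ (Fin 2)) :=
  ENNReal.ofReal r •
    Measure.map
      (fun θ : ℝ => (EuclideanSpace.equiv (Fin 2) ℝ).symm ![r * Real.cos θ, r * Real.sin θ])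
      (volume.restrict (Set.Ico 0 (2 * Real.pi)))

namespace Stmt17Aux

lemma cosh_lower (t : ℝ) : 1 + t ^ 2 / 2 ≤ Real.cosh t := by
  have h : Real.cosh t = 1 + 2 * Real.sinh (t / 2) ^ 2 := by
    have := Real.cosh_two_mul (t / 2)
    rw [Real.cosh_sq] at this
    rw [show t = 2 * (t / 2) by ring, this]
    ring_nf
  have h2 : (t / 2) ^ 2 ≤ Real.sinh (t / 2) ^ 2 := by
    apply sq_le_sq.2
    rw [Real.abs_sinh]
    exact Real.self_le_sinh_iff.2 (abs_nonneg (t / 2))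
  rw [h]; nlinarith

lemma integrable_exp_cosh {c : ℝ} (hc : 0 < c) :
    Integrable (fun t : ℝ => Real.exp (-c * Real.cosh t)) := by
  refine (integrable_exp_neg_mul_sq (half_pos hc)).mono' (by fun_prop) ?_
  filter_upwards with t
  rw [Real.norm_eq_abs, Real.abs_exp]
  apply Real.exp_le_exp.2
  have := cosh_lower t
  nlinarith

lemma integrable_cosh_exp_cosh {c : ℝ} (hc : 0 < c) :
    Integrable (fun t : ℝ => Real.cosh t * Real.exp (-c * Real.cosh t)) := by
  refine ((integrable_exp_cosh (half_pos hc)).const_mul (2 / c)).mono' (by fun_prop) ?_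
  filter_upwards with t
  have hp := Real.cosh_pos t
  rw [Real.norm_eq_abs, abs_mul, Real.abs_exp, abs_of_pos hp]
  have h1 : c / 2 * Real.cosh t ≤ Real.exp (c / 2 * Real.cosh t) := by
    have := Real.add_one_le_exp (c / 2 * Real.cosh t); linarith
  have h2 : Real.exp (-c * Real.cosh t) =
      Real.exp (-(c / 2) * Real.cosh t) * Real.exp (-(c / 2) * Real.cosh t) := by
    rw [← Real.exp_add]; ring_nf
  have h3 : Real.exp (c / 2 * Real.cosh t) * Real.exp (-(c / 2) * Real.cosh t) = 1 := by
    rw [← Real.exp_add]; ring_nf; simp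
  have h4 : c / 2 * Real.cosh t * Real.exp (-(c / 2) * Real.cosh t) ≤ 1 := by
    rw [← h3]; gcongr
  have h5 : Real.cosh t * Real.exp (-(c / 2) * Real.cosh t) ≤ 2 / c := by
    rw [le_div_iff₀ hc]; linarith
  rw [h2, ← mul_assoc]
  gcongr

lemma cosh_re (t b : ℝ) : (Complex.cosh (t + b * Complex.I)).re = Real.cosh t * Real.cos b := by
  rw [Complex.cosh_add, Complex.cosh_mul_I, Complex.sinh_mul_I, ← Complex.ofReal_cosh,
    ← Complex.ofReal_sinh, ← Complex.ofReal_cos, ← Complex.ofReal_sin]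
  simp only [Complex.add_re, Complex.mul_re, Complex.mul_im, Complex.ofReal_re, Complex.ofReal_im,
    Complex.I_re, Complex.I_im]
  ring

lemma norm_sinh_le (t b : ℝ) : ‖Complex.sinh (t + b * Complex.I)‖ ≤ 2 * Real.cosh t := by
  rw [Complex.sinh_add, Complex.cosh_mul_I, Complex.sinh_mul_I, ← Complex.ofReal_cosh,
    ← Complex.ofReal_sinh, ← Complex.ofReal_cos, ← Complex.ofReal_sin]
  refine (norm_add_le _ _).trans ?_
  simp only [norm_mul, Complex.norm_real, Complex.norm_I, mul_one, Real.norm_eq_abs]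
  have h1 := Real.abs_cos_le_one b
  have h2 := Real.abs_sin_le_one b
  have h3 : |Real.sinh t| ≤ Real.cosh t := by
    rw [Real.abs_sinh, ← Real.cosh_abs]; exact (Real.sinh_lt_cosh _).le
  have h4 := Real.cosh_pos t
  rw [abs_of_pos h4]
  have := mul_le_mul h3 h1 (abs_nonneg _) h4.le
  have := mul_le_mul_of_nonneg_left h2 h4.le
  linarith

lemma norm_F (x t b : ℝ) : ‖Complex.exp (-x * Complex.cosh (t + b * Complex.I))‖ =
    Real.exp (-x * (Real.cosh t * Real.cos b)) := by
  rw [Complex.norm_exp, ← Complex.ofReal_neg, Complex.re_ofReal_mul, cosh_re]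

lemma K0_eq (x : ℝ) : ∫ t : ℝ, Real.exp (-x * Real.cosh t) = 2 * besselK0 x := by
  rw [besselK0, ← integral_comp_abs (f := fun t => Real.exp (-x * Real.cosh t))]
  simp only [Real.cosh_abs]

lemma integrable_F {x : ℝ} (hx : 0 < x) {b : ℝ} (hb : 0 < Real.cos b) :
    Integrable (fun t : ℝ => Complex.exp (-x * Complex.cosh (t + b * Complex.I))) := by
  refine (integrable_exp_cosh (mul_pos hx hb)).mono' (by fun_prop) ?_
  filter_upwards with t
  rw [norm_F]
  apply le_of_eq; ring_nf

lemma hasDerivAt_core (x : ℝ) (z : ℂ) :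
    HasDerivAt (fun z : ℂ => Complex.exp (-x * Complex.cosh z))
      (Complex.exp (-x * Complex.cosh z) * (-x * Complex.sinh z)) z :=
  ((Complex.hasDerivAt_cosh z).const_mul (-x : ℂ)).cexp

lemma hasDerivAt_t (x t b : ℝ) :
    HasDerivAt (fun t : ℝ => Complex.exp (-x * Complex.cosh (t + b * Complex.I)))
      (Complex.exp (-x * Complex.cosh (t + b * Complex.I)) *
        (-x * Complex.sinh (t + b * Complex.I))) t := by
  have h : HasDerivAt (fun t : ℝ => (t : ℂ) + b * Complex.I) 1 t :=
    (Complex.ofRealCLM.hasDerivAt (x := t)).add_const _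
  have := (hasDerivAt_core x (t + b * Complex.I)).comp t h
  rw [mul_one] at this
  exact this

lemma hasDerivAt_b (x t b : ℝ) :
    HasDerivAt (fun b : ℝ => Complex.exp (-x * Complex.cosh (t + b * Complex.I)))
      (Complex.I * (Complex.exp (-x * Complex.cosh (t + b * Complex.I)) *
        (-x * Complex.sinh (t + b * Complex.I)))) b := by
  have h : HasDerivAt (fun b : ℝ => (t : ℂ) + b * Complex.I) Complex.I b := by
    simpa using ((Complex.ofRealCLM.hasDerivAt (x := b)).mul_const Complex.I).const_add (t : ℂ)
  have := (hasDerivAt_core x (t + b * Complex.I)).comp b h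
  rw [mul_comm] at this
  exact this

lemma norm_F'_le {x : ℝ} (hx : 0 < x) {c b : ℝ} (hc : c ≤ Real.cos b) (t : ℝ) :
    ‖Complex.exp (-x * Complex.cosh (t + b * Complex.I)) *
        (-x * Complex.sinh (t + b * Complex.I))‖ ≤
      2 * x * (Real.cosh t * Real.exp (-(x * c) * Real.cosh t)) := by
  rw [norm_mul, norm_F, norm_mul, norm_neg, Complex.norm_real, Real.norm_eq_abs, abs_of_pos hx]
  have h1 := norm_sinh_le t b
  have h4 := Real.cosh_pos t
  have h2 : Real.exp (-x * (Real.cosh t * Real.cos b)) ≤ Real.exp (-(x * c) * Real.cosh t) := by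
    apply Real.exp_le_exp.2
    have := mul_le_mul_of_nonneg_left hc (mul_pos hx h4).le
    linarith
  calc _ ≤ Real.exp (-(x * c) * Real.cosh t) * (x * (2 * Real.cosh t)) := by gcongr
    _ = _ := by ring

lemma hasDerivAt_G {x : ℝ} (hx : 0 < x) {b : ℝ} (hb : b ∈ Set.Ioo (-(Real.pi / 2)) (Real.pi / 2)) :
    HasDerivAt (fun b : ℝ => ∫ t : ℝ, Complex.exp (-x * Complex.cosh (t + b * Complex.I))) 0 b := by
  have hcb : 0 < Real.cos b := Real.cos_pos_of_mem_Ioo hb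
  have hs : {b' : ℝ | Real.cos b / 2 < Real.cos b'} ∈ nhds b :=
    (isOpen_lt continuous_const Real.continuous_cos).mem_nhds (by simp; linarith)
  have key := hasDerivAt_integral_of_dominated_loc_of_deriv_le (μ := volume)
    (F := fun (b : ℝ) (t : ℝ) => Complex.exp (-x * Complex.cosh (t + b * Complex.I)))
    (F' := fun (b : ℝ) (t : ℝ) => Complex.I * (Complex.exp (-x * Complex.cosh (t + b * Complex.I)) *
        (-x * Complex.sinh (t + b * Complex.I))))
    (bound := fun t => 2 * x * (Real.cosh t * Real.exp (-(x * (Real.cos b / 2)) * Real.cosh t)))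
    hs (Filter.Eventually.of_forall fun b => by fun_prop) (integrable_F hx hcb) (by fun_prop)
    (Filter.Eventually.of_forall fun t b' hb' => by
      rw [norm_mul, Complex.norm_I, one_mul]
      exact norm_F'_le hx (le_of_lt hb') t)
    ((integrable_cosh_exp_cosh (mul_pos hx (half_pos hcb))).const_mul _)
    (Filter.Eventually.of_forall fun t b' hb' => hasDerivAt_b x t b')
  have h0 : ∫ t : ℝ, (Complex.exp (-x * Complex.cosh (t + b * Complex.I)) *
        (-x * Complex.sinh (t + b * Complex.I))) = 0 := by
    refine integral_eq_zero_of_hasDerivAt_of_integrable (fun t => hasDerivAt_t x t b) ?_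
      (integrable_F hx hcb)
    refine ((integrable_cosh_exp_cosh (mul_pos hx hcb)).const_mul (2 * x)).mono' (by fun_prop) ?_
    filter_upwards with t
    exact norm_F'_le hx le_rfl t
  have := key.2
  rwa [integral_const_mul, h0, mul_zero] at this

lemma shift {x : ℝ} (hx : 0 < x) {b : ℝ} (hb : b ∈ Set.Ioo (-(Real.pi / 2)) (Real.pi / 2)) :
    ∫ t : ℝ, Complex.exp (-x * Complex.cosh (t + b * Complex.I)) = ((2 * besselK0 x : ℝ) : ℂ) := by
  have h := isOpen_Ioo.is_const_of_deriv_eq_zero (𝕜 := ℝ) isPreconnected_Ioo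
    (fun y hy => (hasDerivAt_G hx hy).differentiableAt.differentiableWithinAt)
    (fun y hy => (hasDerivAt_G hx hy).deriv) hb
    (show (0 : ℝ) ∈ Set.Ioo (-(Real.pi / 2)) (Real.pi / 2) by
      constructor <;> linarith [Real.pi_pos])
  rw [h, ← K0_eq, ← integral_complex_ofReal]
  congr 1
  ext t
  push_cast
  simp

lemma kernel_eq {a : ℝ} (ha : 0 < a) {p : ℝ} (hp : p ∈ Set.Ioc (-Real.pi) Real.pi) (hp0 : p ≠ 0) :
    ∫ t : ℝ, Complex.exp (-a * Complex.cosh t + a * Complex.cosh (t + p * Complex.I)) =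
      ((2 * besselK0 (2 * a * |Real.sin (p / 2)|) : ℝ) : ℂ) := by
  obtain ⟨h1, h2⟩ := hp
  have hpi := Real.pi_pos
  have e (m w : ℂ) : Complex.cosh (m - w) - Complex.cosh (m + w) =
      -2 * (Complex.sinh m * Complex.sinh w) := by
    rw [Complex.cosh_sub, Complex.cosh_add]; ring
  have e2 (t : ℝ) : -(a:ℂ) * Complex.cosh t + a * Complex.cosh (t + p * Complex.I) =
      2 * a * Complex.sinh (t + (p / 2) * Complex.I) * (Complex.sin (p / 2) * Complex.I) := by
    have := e (t + (p / 2) * Complex.I) ((p / 2) * Complex.I)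
    rw [Complex.sinh_mul_I] at this
    rw [show (t:ℂ) + (p / 2) * Complex.I - (p / 2) * Complex.I = t by ring,
      show (t:ℂ) + (p / 2) * Complex.I + (p / 2) * Complex.I = t + p * Complex.I by ring] at this
    linear_combination (-a : ℂ) * this
  rcases lt_or_gt_of_ne hp0 with h | h
  · have hs : Real.sin (p / 2) < 0 := Real.sin_neg_of_neg_of_neg_pi_lt (by linarith) (by linarith)
    rw [abs_of_neg hs, ← shift (b := p / 2 + Real.pi / 2) (by nlinarith)
      ⟨by linarith, by linarith⟩]
    congr 1; ext t
    rw [e2]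
    congr 1
    push_cast
    rw [show (t:ℂ) + (p / 2 + Real.pi / 2) * Complex.I =
      (t + (p / 2) * Complex.I) + (Real.pi / 2) * Complex.I by ring, Complex.cosh_add _ ((Real.pi / 2) * Complex.I),
      Complex.cosh_mul_I, Complex.sinh_mul_I, Complex.cos_pi_div_two, Complex.sin_pi_div_two]
    ring
  · have hs : 0 < Real.sin (p / 2) := Real.sin_pos_of_pos_of_lt_pi (by linarith) (by linarith)
    rw [abs_of_pos hs, ← shift (b := p / 2 - Real.pi / 2) (by nlinarith)
      ⟨by linarith, by linarith⟩]
    congr 1; ext t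
    rw [e2]
    congr 1
    push_cast
    rw [show (t:ℂ) + (p / 2 - Real.pi / 2) * Complex.I =
      (t + (p / 2) * Complex.I) - (Real.pi / 2) * Complex.I by ring, Complex.cosh_sub _ ((Real.pi / 2) * Complex.I),
      Complex.cosh_mul_I, Complex.sinh_mul_I, Complex.cos_pi_div_two, Complex.sin_pi_div_two]
    ring

lemma I0_eq (a t : ℝ) :
    ∫ p in (-Real.pi)..Real.pi, Complex.exp (a * Complex.cosh (t + p * Complex.I)) =
      ((2 * Real.pi * besselI0 a : ℝ) : ℂ) := by
  have h := Complex.integral_boundary_rect_eq_zero_of_differentiableOn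
    (fun z => Complex.exp (a * Complex.cosh z)) (⟨0, -Real.pi⟩ : ℂ) (⟨t, Real.pi⟩ : ℂ)
    (by
      apply Differentiable.differentiableOn
      fun_prop)
  simp only [smul_eq_mul] at h
  have hper (x : ℝ) : Complex.cosh ((x : ℂ) + (-Real.pi : ℝ) * Complex.I) =
      Complex.cosh ((x : ℂ) + Real.pi * Complex.I) := by
    push_cast
    rw [Complex.cosh_add, Complex.cosh_add, Complex.cosh_mul_I, Complex.sinh_mul_I,
      Complex.cosh_mul_I, Complex.sinh_mul_I]
    simp
  simp only [hper, sub_self, zero_add, ← mul_sub] at h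
  have h' := sub_eq_zero.1 ((mul_eq_zero.1 h).resolve_left Complex.I_ne_zero)
  rw [h']
  have e : ∀ p : ℝ, Complex.exp (a * Complex.cosh (((0 : ℝ) : ℂ) + p * Complex.I)) =
      ((Real.exp (a * Real.cos p) : ℝ) : ℂ) := by
    intro p
    push_cast
    rw [zero_add, Complex.cosh_mul_I]
  simp only [e]
  rw [intervalIntegral.integral_ofReal]
  congr 1
  have hi : ∀ u v : ℝ, IntervalIntegrable (fun p => Real.exp (a * Real.cos p)) volume u v :=
    fun u v => Continuous.intervalIntegrable (by fun_prop) _ _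
  rw [← intervalIntegral.integral_add_adjacent_intervals (hi _ 0) (hi 0 _)]
  have hn : ∫ p in (-Real.pi)..0, Real.exp (a * Real.cos p) =
      ∫ p in (0:ℝ)..Real.pi, Real.exp (a * Real.cos p) := by
    have := intervalIntegral.integral_comp_neg (a := 0) (b := Real.pi)
      (fun p => Real.exp (a * Real.cos p))
    simp only [Real.cos_neg, neg_zero] at this
    exact this.symm
  rw [hn, besselI0]
  field_simp
  ring

lemma integrable_H {a : ℝ} (ha : 0 < a) :
    Integrable (fun q : ℝ × ℝ =>
      Complex.exp (-a * Complex.cosh q.1 + a * Complex.cosh (q.1 + q.2 * Complex.I)))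
      (volume.prod (volume.restrict (Set.Ioc (-Real.pi) Real.pi))) := by
  have hpi := Real.pi_pos
  set c : ℝ := a * (2 / Real.pi ^ 2) with hc
  have hc0 : 0 < c := by positivity
  have hg : Integrable (fun q : ℝ × ℝ => Real.exp (-(c * Real.cosh q.1) * q.2 ^ 2))
      (volume.prod volume) := by
    rw [integrable_prod_iff (by fun_prop)]
    refine ⟨Filter.Eventually.of_forall fun t =>
      integrable_exp_neg_mul_sq (mul_pos hc0 (Real.cosh_pos t)), ?_⟩
    simp only [Real.norm_eq_abs, Real.abs_exp, integral_gaussian]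
    refine (integrable_inv_one_add_sq.const_mul (8 * √(Real.pi / c))).mono'
      (by
        have : Measurable fun t : ℝ => √(Real.pi / (c * Real.cosh t)) := by fun_prop
        exact this.aestronglyMeasurable) ?_
    filter_upwards with t
    rw [Real.norm_eq_abs, abs_of_nonneg (Real.sqrt_nonneg _)]
    have h1 : (1 + t ^ 2 / 8) ^ 2 ≤ Real.cosh t := by
      have h2 := cosh_lower (t / 2)
      have h3 : Real.cosh t = Real.cosh (t / 2) ^ 2 + Real.sinh (t / 2) ^ 2 := by
        rw [← Real.cosh_two_mul]; congr 1; ring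
      rw [h3]
      have : (1 + t ^ 2 / 8) ^ 2 ≤ Real.cosh (t / 2) ^ 2 := by
        apply pow_le_pow_left₀ (by positivity)
        linarith
      nlinarith [sq_nonneg (Real.sinh (t / 2))]
    have h4 : Real.pi / (c * Real.cosh t) ≤ (8 * √(Real.pi / c) * (1 + t ^ 2)⁻¹) ^ 2 := by
      rw [mul_pow, mul_pow, Real.sq_sqrt (by positivity)]
      have h5 : (1 + t ^ 2) ^ 2 ≤ 64 * Real.cosh t := by nlinarith
      have h6 := Real.cosh_pos t
      rw [inv_pow, div_mul_eq_div_div, ← div_eq_mul_inv, div_le_div_iff₀ h6 (by positivity)]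
      have : 0 < Real.pi / c := by positivity
      nlinarith
    exact (Real.sqrt_le_sqrt h4).trans_eq (Real.sqrt_sq (by positivity))
  have hg2 : Integrable (fun q : ℝ × ℝ => Real.exp (-(c * Real.cosh q.1) * q.2 ^ 2))
      (volume.prod (volume.restrict (Set.Ioc (-Real.pi) Real.pi))) := by
    refine hg.mono_measure ?_
    exact Measure.prod_mono le_rfl Measure.restrict_le_self
  refine hg2.mono' (by fun_prop) ?_
  have hae : ∀ᵐ q : ℝ × ℝ ∂(volume.prod (volume.restrict (Set.Ioc (-Real.pi) Real.pi))),
      q.2 ∈ Set.Ioc (-Real.pi) Real.pi :=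
    Measure.quasiMeasurePreserving_snd.ae (ae_restrict_mem measurableSet_Ioc)
  filter_upwards [hae] with q hq
  rw [Complex.norm_exp]
  apply Real.exp_le_exp.2
  rw [Complex.add_re, ← Complex.ofReal_neg, Complex.re_ofReal_mul, Complex.re_ofReal_mul, cosh_re,
    Complex.cosh_ofReal_re]
  have h1 := Real.cos_le_one_sub_mul_cos_sq (x := q.2) (abs_le.2 ⟨hq.1.le, hq.2⟩)
  have h2 := mul_le_mul_of_nonneg_left h1 (mul_pos ha (Real.cosh_pos q.1)).le
  rw [hc]
  nlinarith

lemma main_integral {a : ℝ} (ha : 0 < a) :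
    ∫ p in (-Real.pi)..Real.pi, besselK0 (2 * a * |Real.sin (p / 2)|) =
      2 * Real.pi * besselI0 a * besselK0 a := by
  have hpi := Real.pi_pos
  have hsw := integral_integral_swap (μ := volume)
    (ν := volume.restrict (Set.Ioc (-Real.pi) Real.pi))
    (f := fun t p : ℝ => Complex.exp (-a * Complex.cosh t + a * Complex.cosh (t + p * Complex.I)))
    (integrable_H ha)
  have hL : ∀ t : ℝ, ∫ p in Set.Ioc (-Real.pi) Real.pi,
      Complex.exp (-a * Complex.cosh t + a * Complex.cosh (t + p * Complex.I)) =
      ((Real.exp (-a * Real.cosh t) * (2 * Real.pi * besselI0 a) : ℝ) : ℂ) := by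
    intro t
    simp only [Complex.exp_add]
    rw [integral_const_mul, ← intervalIntegral.integral_of_le (by linarith), I0_eq]
    push_cast
    rfl
  have hR : ∫ p in Set.Ioc (-Real.pi) Real.pi, ∫ t : ℝ,
      Complex.exp (-a * Complex.cosh t + a * Complex.cosh (t + p * Complex.I)) =
      ∫ p in Set.Ioc (-Real.pi) Real.pi,
        ((2 * besselK0 (2 * a * |Real.sin (p / 2)|) : ℝ) : ℂ) := by
    apply integral_congr_ae
    have h0 : ∀ᵐ p : ℝ ∂(volume.restrict (Set.Ioc (-Real.pi) Real.pi)), p ≠ 0 :=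
      ae_restrict_of_ae (Measure.ae_ne volume 0)
    filter_upwards [h0, ae_restrict_mem measurableSet_Ioc] with p hp0 hp
    exact kernel_eq ha hp hp0
  rw [hR] at hsw
  simp only [hL] at hsw
  rw [integral_complex_ofReal, integral_complex_ofReal, Complex.ofReal_inj, integral_mul_const,
    K0_eq, integral_const_mul] at hsw
  rw [intervalIntegral.integral_of_le (by linarith)]
  linarith

lemma measurable_K0 : StronglyMeasurable besselK0 := by
  unfold besselK0
  apply StronglyMeasurable.integral_prod_right (f := fun x t : ℝ => Real.exp (-x * Real.cosh t))
  apply Continuous.stronglyMeasurable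
  unfold Function.uncurry
  fun_prop

noncomputable def par (r θ : ℝ) : EuclideanSpace ℝ (Fin 2) :=
  (EuclideanSpace.equiv (Fin 2) ℝ).symm ![r * Real.cos θ, r * Real.sin θ]

lemma continuous_par (r : ℝ) : Continuous (par r) := by
  unfold par
  apply (EuclideanSpace.equiv (Fin 2) ℝ).symm.continuous.comp
  apply continuous_pi
  intro i
  fin_cases i <;> simp <;> fun_prop

lemma dist_par {r : ℝ} (hr : 0 < r) (θ φ : ℝ) :
    dist (par r θ) (par r φ) = 2 * r * |Real.sin ((φ - θ) / 2)| := by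
  rw [EuclideanSpace.dist_eq, Fin.sum_univ_two]
  simp only [par, Real.dist_eq, sq_abs]
  simp
  rw [show 2 * r * |Real.sin ((φ - θ) / 2)| = |2 * r * Real.sin ((φ - θ) / 2)| by
    rw [abs_mul, abs_of_pos (by positivity : 0 < 2 * r)], ← Real.sqrt_sq_eq_abs]
  congr 1
  have h := Real.cos_sub φ θ
  have h2 : Real.sin ((φ - θ) / 2) ^ 2 = 1 / 2 - Real.cos (φ - θ) / 2 := by
    rw [Real.sin_sq_eq_half_sub]; ring_nf
  rw [mul_pow, h2, h]
  have := Real.sin_sq_add_cos_sq θ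
  have := Real.sin_sq_add_cos_sq φ
  linear_combination r ^ 2 * (Real.sin_sq_add_cos_sq θ) + r ^ 2 * (Real.sin_sq_add_cos_sq φ)

lemma integral_circle {r : ℝ} (hr : 0 < r) {f : EuclideanSpace ℝ (Fin 2) → ℝ}
    (hf : StronglyMeasurable f) :
    ∫ x, f x ∂(circleMeasure r) = r * ∫ θ in Set.Ico 0 (2 * Real.pi), f (par r θ) := by
  change ∫ x, f x ∂(ENNReal.ofReal r • Measure.map (par r) _) = _
  rw [integral_smul_measure, integral_map (continuous_par r).aemeasurable hf.aestronglyMeasurable,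
    ENNReal.toReal_ofReal hr.le, smul_eq_mul]

instance (r : ℝ) : SFinite (circleMeasure r) := by
  unfold circleMeasure; infer_instance

lemma inner_eq {r k : ℝ} (hr : 0 < r) (hk : 0 < k) (θ : ℝ) :
    ∫ φ in Set.Ico 0 (2 * Real.pi), besselK0 (k * dist (par r θ) (par r φ)) =
      2 * Real.pi * besselI0 (k * r) * besselK0 (k * r) := by
  have hpi := Real.pi_pos
  rw [← main_integral (mul_pos hk hr), integral_Ico_eq_integral_Ioc,
    ← intervalIntegral.integral_of_le (by linarith)]
  have e : ∀ φ, besselK0 (k * dist (par r θ) (par r φ)) =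
      (fun p => besselK0 (2 * (k * r) * |Real.sin (p / 2)|)) (φ - θ) := by
    intro φ
    simp only [dist_par hr]
    ring_nf
  simp only [e]
  rw [intervalIntegral.integral_comp_sub_right
    (fun p => besselK0 (2 * (k * r) * |Real.sin (p / 2)|))]
  have hper : Function.Periodic (fun p => besselK0 (2 * (k * r) * |Real.sin (p / 2)|))
      (2 * Real.pi) := by
    intro p
    simp only
    rw [show (p + 2 * Real.pi) / 2 = p / 2 + Real.pi by ring, Real.sin_add_pi, abs_neg]
  have := hper.intervalIntegral_add_eq (0 - θ) (-Real.pi)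
  rw [show 0 - θ + 2 * Real.pi = 2 * Real.pi - θ by ring,
    show -Real.pi + 2 * Real.pi = Real.pi by ring] at this
  exact this

end Stmt17Aux

open Stmt17Aux

theorem stmt17 (r : ℝ) (hr : 0 < r) (k : ℝ) (hk : 0 < k) :
    (1 / (2 * Real.pi)) *
        ∫ x, ∫ y, besselK0 (k * dist x y) ∂(circleMeasure r) ∂(circleMeasure r) =
      2 * Real.pi * r ^ 2 * besselI0 (k * r) * besselK0 (k * r) := by
  have hpi := Real.pi_pos
  have hm : StronglyMeasurable (fun q : EuclideanSpace ℝ (Fin 2) × EuclideanSpace ℝ (Fin 2) =>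
      besselK0 (k * dist q.1 q.2)) :=
    measurable_K0.comp_measurable (by fun_prop)
  rw [integral_circle hr (hm.integral_prod_right' (ν := circleMeasure r))]
  have h : ∀ θ : ℝ, ∫ y, besselK0 (k * dist (par r θ) y) ∂(circleMeasure r) =
      r * (2 * Real.pi * besselI0 (k * r) * besselK0 (k * r)) := by
    intro θ
    have hm2 : StronglyMeasurable (fun y : EuclideanSpace ℝ (Fin 2) =>
        besselK0 (k * dist (par r θ) y)) := measurable_K0.comp_measurable (by fun_prop)
    rw [integral_circle hr hm2, inner_eq hr hk]
  simp only [h]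
  rw [setIntegral_const, Real.volume_real_Ico_of_le (by linarith), smul_eq_mul]
  field_simp
  ring
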